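/- arXiv:math/0601020 — 3 statements merged into one kernel-verified Lean document; each statement's English description precedes it below -/
import Mathlib

section
/- For x = (x¹,…,x⁸) ∈ ℝ⁸ let ι(x) be the antisymmetric 7×7 real matrix in block form [[0₃ₓ₃, α(x)], [−α(x)ᵗ, 0₄ₓ₄]], where α(x) is the 3×4 matrix with rows (−x³ + √3·x⁴, −x⁵ + √3·x⁶, −x⁷ + √3·x⁸, −2x¹), (−x¹ − √3·x², x⁷ + √3·x⁸, −x⁵ − √3·x⁶, 2x³), (−2x⁷, x¹ − √3·x², −x³ − √3·x⁴, −2x⁵). Then the characteristic polynomial of ι(x) satisfies det(ι(x) − λ·I₇) = −λ⁷ − 6·|x|²·λ⁵ − 9·(|x|²)²·λ³ + 2·Φ(x)·λ for all λ ∈ ℝ, where |x|² = (x¹)² + ⋯ + (x⁸)² and Φ(x) is defined as half the coefficient of λ¹ in det(ι(x) − λ·I₇); in particular the coefficients of λ⁰, λ², λ⁴, λ⁶ vanish, the coefficient of λ⁷ is −1, of λ⁵ is −6|x|², and of λ³ is −9(|x|²)². -/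
open Matrix Polynomial

/-- The linear embedding `ι : ℝ⁸ → M₇ₓ₇(ℝ)` onto the space `𝕄⁸` of antisymmetric
7×7 matrices defining the `SU(2)×SU(2)` structure in dimension 8. -/
noncomputable def iota8 (x : Fin 8 → ℝ) : Matrix (Fin 7) (Fin 7) ℝ :=
  !![0, 0, 0, -x 2 + Real.sqrt 3 * x 3, -x 4 + Real.sqrt 3 * x 5,
       -x 6 + Real.sqrt 3 * x 7, -2 * x 0;
     0, 0, 0, -x 0 - Real.sqrt 3 * x 1, x 6 + Real.sqrt 3 * x 7,
       -x 4 - Real.sqrt 3 * x 5, 2 * x 2;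
     0, 0, 0, -2 * x 6, x 0 - Real.sqrt 3 * x 1, -x 2 - Real.sqrt 3 * x 3, -2 * x 4;
     x 2 - Real.sqrt 3 * x 3, x 0 + Real.sqrt 3 * x 1, 2 * x 6, 0, 0, 0, 0;
     x 4 - Real.sqrt 3 * x 5, -x 6 - Real.sqrt 3 * x 7, -x 0 + Real.sqrt 3 * x 1,
       0, 0, 0, 0;
     x 6 - Real.sqrt 3 * x 7, x 4 + Real.sqrt 3 * x 5, x 2 + Real.sqrt 3 * x 3,
       0, 0, 0, 0;
     2 * x 0, -2 * x 2, 2 * x 4, 0, 0, 0, 0]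

/-- The polynomial `λ ↦ det(ι(x) − λ·I₇)`. -/
noncomputable def charP8 (x : Fin 8 → ℝ) : Polynomial ℝ :=
  ((iota8 x).map Polynomial.C
    - (Polynomial.X : Polynomial ℝ) • (1 : Matrix (Fin 7) (Fin 7) (Polynomial ℝ))).det

/-- The sextic invariant `Φ(x)`, half the coefficient of `λ¹` in `det(ι(x) − λI₇)`. -/
noncomputable def Phi8 (x : Fin 8 → ℝ) : ℝ := (1 / 2) * (charP8 x).coeff 1

/-- The determinant of the skew block matrix, via a block elimination. -/
theorem skew_block_det {R : Type*} [CommRing R] [IsDomain R] (A : Matrix (Fin 3) (Fin 4) R)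
    (l : R) (hl : l ≠ 0) :
    (fromBlocks (-(l • (1 : Matrix (Fin 3) (Fin 3) R))) A (-Aᵀ)
      (-(l • (1 : Matrix (Fin 4) (Fin 4) R)))).det
      = l * (-(l ^ 2 • (1 : Matrix (Fin 3) (Fin 3) R)) - A * Aᵀ).det := by
  have h : fromBlocks (-(l • (1 : Matrix (Fin 3) (Fin 3) R))) A (-Aᵀ)
      (-(l • (1 : Matrix (Fin 4) (Fin 4) R)))
      * fromBlocks (l • (1 : Matrix (Fin 3) (Fin 3) R)) 0 (-Aᵀ) 1
      = fromBlocks (-(l ^ 2 • (1 : Matrix (Fin 3) (Fin 3) R)) - A * Aᵀ) A 0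
        (-(l • (1 : Matrix (Fin 4) (Fin 4) R))) := by
    rw [fromBlocks_multiply]
    congr 1 <;> simp [smul_smul, pow_two, sub_eq_add_neg]
  have h2 := congrArg det h
  rw [det_mul, det_fromBlocks_zero₁₂, det_fromBlocks_zero₂₁, det_neg, det_smul, det_smul] at h2
  simp only [Fintype.card_fin, det_one, mul_one] at h2
  have h3 : l ^ 3 ≠ 0 := pow_ne_zero _ hl
  apply mul_right_cancel₀ h3
  rw [h2]
  ring

/-- The upper right block. -/
noncomputable def alpha8 (x : Fin 8 → ℝ) : Matrix (Fin 3) (Fin 4) ℝ :=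
  !![-x 2 + Real.sqrt 3 * x 3, -x 4 + Real.sqrt 3 * x 5, -x 6 + Real.sqrt 3 * x 7, -2 * x 0;
     -x 0 - Real.sqrt 3 * x 1, x 6 + Real.sqrt 3 * x 7, -x 4 - Real.sqrt 3 * x 5, 2 * x 2;
     -2 * x 6, x 0 - Real.sqrt 3 * x 1, -x 2 - Real.sqrt 3 * x 3, -2 * x 4]

theorem iota8_blocks (x : Fin 8 → ℝ) :
    iota8 x = (fromBlocks 0 (alpha8 x) (-(alpha8 x)ᵀ) 0).submatrix
      (finSumFinEquiv (m := 3) (n := 4)).symm (finSumFinEquiv (m := 3) (n := 4)).symm := by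
  rw [← Matrix.submatrix_id_id (iota8 x)]
  rw [← Equiv.self_comp_symm (finSumFinEquiv (m := 3) (n := 4)), ← Matrix.submatrix_submatrix]
  congr 1
  ext i j
  rcases i with i | i <;> rcases j with j | j <;> fin_cases i <;> fin_cases j <;>
    simp [iota8, alpha8, finSumFinEquiv] <;> first | rfl | ring

theorem charP8_blocks (x : Fin 8 → ℝ) :
    charP8 x = X * (-((X : ℝ[X]) ^ 2 • (1 : Matrix (Fin 3) (Fin 3) ℝ[X]))
      - (alpha8 x * (alpha8 x)ᵀ).map C).det := by
  have h : (iota8 x).map C - (X : ℝ[X]) • (1 : Matrix (Fin 7) (Fin 7) ℝ[X])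
      = (fromBlocks (-((X : ℝ[X]) • (1 : Matrix (Fin 3) (Fin 3) ℝ[X]))) ((alpha8 x).map C)
        (-((alpha8 x).map C)ᵀ) (-((X : ℝ[X]) • (1 : Matrix (Fin 4) (Fin 4) ℝ[X])))).submatrix
        (finSumFinEquiv (m := 3) (n := 4)).symm (finSumFinEquiv (m := 3) (n := 4)).symm := by
    rw [iota8_blocks, ← submatrix_one_equiv (finSumFinEquiv (m := 3) (n := 4)).symm]
    ext1 i j
    simp only [Matrix.sub_apply, Matrix.smul_apply, submatrix_apply, Matrix.map_apply]
    generalize (finSumFinEquiv (m := 3) (n := 4)).symm i = i'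
    generalize (finSumFinEquiv (m := 3) (n := 4)).symm j = j'
    rcases i' with i' | i' <;> rcases j' with j' | j' <;> simp [Matrix.one_apply]
  rw [charP8, h, det_submatrix_equiv_self, skew_block_det _ _ X_ne_zero, Matrix.map_mul,
    transpose_map]

theorem charP8_explicit (x : Fin 8 → ℝ) : ∃ c : ℝ,
    charP8 x = -X ^ 7 - C (6 * (∑ i, (x i) ^ 2)) * X ^ 5 - C (9 * (∑ i, (x i) ^ 2) ^ 2) * X ^ 3
      + C c * X := by
  set G := alpha8 x * (alpha8 x)ᵀ with hG
  have hs : Real.sqrt 3 ^ 2 = 3 := Real.sq_sqrt (by norm_num)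
  have hE : ∀ i j, G i j = alpha8 x i 0 * alpha8 x j 0 + alpha8 x i 1 * alpha8 x j 1
      + alpha8 x i 2 * alpha8 x j 2 + alpha8 x i 3 * alpha8 x j 3 := by
    intro i j
    simp only [hG, Matrix.mul_apply, Matrix.transpose_apply, Fin.sum_univ_four]
  have e1 : 6 * (∑ i, (x i) ^ 2) = G 0 0 + G 1 1 + G 2 2 := by
    simp only [hE, Fin.sum_univ_eight]
    simp only [alpha8, of_apply, cons_val]
    generalize Real.sqrt 3 = s at hs
    generalize x 0 = y0, x 1 = y1, x 2 = y2, x 3 = y3, x 4 = y4, x 5 = y5, x 6 = y6, x 7 = y7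
    clear hE
    grind
  have e2 : 9 * (∑ i, (x i) ^ 2) ^ 2 = G 0 0 * G 1 1 - G 0 1 * G 1 0 + G 0 0 * G 2 2
      - G 0 2 * G 2 0 + G 1 1 * G 2 2 - G 1 2 * G 2 1 := by
    simp only [hE, Fin.sum_univ_eight]
    simp only [alpha8, of_apply, cons_val]
    generalize Real.sqrt 3 = s at hs
    generalize x 0 = y0, x 1 = y1, x 2 = y2, x 3 = y3, x 4 = y4, x 5 = y5, x 6 = y6, x 7 = y7
    clear hE
    grind
  refine ⟨-G.det, ?_⟩
  rw [charP8_blocks, e1, e2, ← hG, det_fin_three, det_fin_three]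
  simp
  ring

/-- `det(ι(x) − λI₇) = −λ⁷ − 6|x|²λ⁵ − 9(|x|²)²λ³ + 2Φ(x)λ`: the coefficients of
`λ⁰, λ², λ⁴, λ⁶` vanish, the coefficient of `λ⁷` is `−1`, of `λ⁵` is `−6|x|²`, and of
`λ³` is `−9(|x|²)²`. -/
theorem statement15 (x : Fin 8 → ℝ) :
    (∀ l : ℝ, (iota8 x - l • (1 : Matrix (Fin 7) (Fin 7) ℝ)).det =
      -l ^ 7 - 6 * (∑ i, (x i) ^ 2) * l ^ 5 - 9 * (∑ i, (x i) ^ 2) ^ 2 * l ^ 3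
        + 2 * Phi8 x * l) ∧
    (charP8 x).coeff 0 = 0 ∧ (charP8 x).coeff 2 = 0 ∧ (charP8 x).coeff 4 = 0 ∧
    (charP8 x).coeff 6 = 0 ∧ (charP8 x).coeff 7 = -1 ∧
    (charP8 x).coeff 5 = -6 * (∑ i, (x i) ^ 2) ∧
    (charP8 x).coeff 3 = -9 * (∑ i, (x i) ^ 2) ^ 2 := by
  obtain ⟨c, hc⟩ := charP8_explicit x
  generalize ha : 6 * (∑ i, (x i) ^ 2) = a at hc ⊢
  generalize hb : 9 * (∑ i, (x i) ^ 2) ^ 2 = b at hc ⊢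
  rw [neg_mul, neg_mul, ha, hb]
  have hPhi : Phi8 x = 1 / 2 * c := by
    rw [Phi8, hc]
    simp [coeff_X, coeff_X_pow, -map_mul, -map_pow]
  refine ⟨fun l => ?_, ?_, ?_, ?_, ?_, ?_, ?_, ?_⟩
  · have h : (iota8 x - l • (1 : Matrix (Fin 7) (Fin 7) ℝ)).det = (charP8 x).eval l := by
      rw [charP8, ← coe_evalRingHom, RingHom.map_det]
      congr 1
      ext i j
      by_cases hij : i = j <;> simp [hij, Matrix.one_apply]
    rw [h, hc, hPhi]
    simp
  all_goals
    rw [hc]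
    simp [coeff_X, coeff_X_pow, -map_mul, -map_pow]
end

section
/- Let Φ: ℝ⁸ → ℝ be the degree-6 homogeneous polynomial defined by Φ(x) = (1/2)·(coefficient of λ¹ in det(ι(x) − λ·I₇)), where ι(x) is the antisymmetric 7×7 matrix [[0₃ₓ₃, α(x)], [−α(x)ᵗ, 0₄ₓ₄]] with α(x) having rows (−x³ + √3·x⁴, −x⁵ + √3·x⁶, −x⁷ + √3·x⁸, −2x¹), (−x¹ − √3·x², x⁷ + √3·x⁸, −x⁵ − √3·x⁶, 2x³), (−2x⁷, x¹ − √3·x², −x³ − √3·x⁴, −2x⁵). Then: (a) ΔΦ(x) = −72·(|x|²)² for all x ∈ ℝ⁸; and (b) |∇Φ(x)|² = −72·Φ(x)·(|x|²)² for all x ∈ ℝ⁸. -/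
open Matrix Polynomial

/-- the signed 3×3 minors of `α`, in the variables `x¹, √3x², x³, √3x⁴, …` -/
def minorN (a b c d e f g h : ℝ) : Fin 4 → ℝ :=
  ![-2*a^2*e - 2*a^2*f + 2*a*b*e + 2*a*b*f + 4*a*c*h + 2*a*d*g + 2*a*d*h + 2*b*c*g - 2*b*c*h - 2*c^2*e + 2*c^2*f - 2*c*d*e + 2*c*d*f - 2*e^3 + 2*e*f^2 - 2*e*g^2 + 2*e*h^2,
    2*a^2*c + 2*a^2*d + 2*a*b*c + 2*a*b*d - 6*a*e*g + 2*a*e*h - 4*a*f*g - 2*b*e*g + 2*b*e*h + 2*c^3 - 2*c*d^2 + 2*c*e^2 + 2*c*e*f - 4*c*g^2 + 4*c*g*h - 2*d*e^2 - 2*d*e*f,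
    2*a^3 - 2*a*b^2 + 2*a*c^2 - 2*a*c*d + 2*a*e^2 - 2*a*e*f - 4*a*g^2 - 4*a*g*h - 2*b*c^2 + 2*b*c*d + 2*b*e^2 - 2*b*e*f + 6*c*e*g + 2*c*e*h - 4*c*f*g - 2*d*e*g - 2*d*e*h,
    -a^2*g + a^2*h + 2*a*c*f - 2*a*d*e + b^2*g - b^2*h - 2*b*c*e + 2*b*d*f - c^2*g - c^2*h + d^2*g + d^2*h + 2*e^2*g - 2*f^2*g + 2*g^3 - 2*g*h^2]

/-- first partial derivatives -/
def gradN (a b c d e f g h : ℝ) : Fin 4 → Fin 8 → ℝ :=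
  ![![-4*a*e - 4*a*f + 2*b*e + 2*b*f + 4*c*h + 2*d*g + 2*d*h,
      2*a*e + 2*a*f + 2*c*g - 2*c*h,
      4*a*h + 2*b*g - 2*b*h - 4*c*e + 4*c*f - 2*d*e + 2*d*f,
      2*a*g + 2*a*h - 2*c*e + 2*c*f,
      -2*a^2 + 2*a*b - 2*c^2 - 2*c*d - 6*e^2 + 2*f^2 - 2*g^2 + 2*h^2,
      -2*a^2 + 2*a*b + 2*c^2 + 2*c*d + 4*e*f,
      2*a*d + 2*b*c - 4*e*g,
      4*a*c + 2*a*d - 2*b*c + 4*e*h],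
    ![4*a*c + 4*a*d + 2*b*c + 2*b*d - 6*e*g + 2*e*h - 4*f*g,
      2*a*c + 2*a*d - 2*e*g + 2*e*h,
      2*a^2 + 2*a*b + 6*c^2 - 2*d^2 + 2*e^2 + 2*e*f - 4*g^2 + 4*g*h,
      2*a^2 + 2*a*b - 4*c*d - 2*e^2 - 2*e*f,
      -6*a*g + 2*a*h - 2*b*g + 2*b*h + 4*c*e + 2*c*f - 4*d*e - 2*d*f,
      -4*a*g + 2*c*e - 2*d*e,
      -6*a*e - 4*a*f - 2*b*e - 8*c*g + 4*c*h,
      2*a*e + 2*b*e + 4*c*g],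
    ![6*a^2 - 2*b^2 + 2*c^2 - 2*c*d + 2*e^2 - 2*e*f - 4*g^2 - 4*g*h,
      -4*a*b - 2*c^2 + 2*c*d + 2*e^2 - 2*e*f,
      4*a*c - 2*a*d - 4*b*c + 2*b*d + 6*e*g + 2*e*h - 4*f*g,
      -2*a*c + 2*b*c - 2*e*g - 2*e*h,
      4*a*e - 2*a*f + 4*b*e - 2*b*f + 6*c*g + 2*c*h - 2*d*g - 2*d*h,
      -2*a*e - 2*b*e - 4*c*g,
      -8*a*g - 4*a*h + 6*c*e - 4*c*f - 2*d*e,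
      -4*a*g + 2*c*e - 2*d*e],
    ![-2*a*g + 2*a*h + 2*c*f - 2*d*e,
      2*b*g - 2*b*h - 2*c*e + 2*d*f,
      2*a*f - 2*b*e - 2*c*g - 2*c*h,
      -2*a*e + 2*b*f + 2*d*g + 2*d*h,
      -2*a*d - 2*b*c + 4*e*g,
      2*a*c + 2*b*d - 4*f*g,
      -a^2 + b^2 - c^2 + d^2 + 2*e^2 - 2*f^2 + 6*g^2 - 2*h^2,
      a^2 - b^2 - c^2 + d^2 - 4*g*h]]

/-- pure second partial derivatives -/
def hessN (a b c d e f g h : ℝ) : Fin 4 → Fin 8 → ℝ :=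
  ![![-4*e - 4*f,
      0,
      -4*e + 4*f,
      0,
      -12*e,
      4*e,
      -4*e,
      4*e],
    ![4*c + 4*d,
      0,
      12*c,
      -4*c,
      4*c - 4*d,
      0,
      -8*c,
      0],
    ![12*a,
      -4*a,
      4*a - 4*b,
      0,
      4*a + 4*b,
      0,
      -8*a,
      0],
    ![-2*g + 2*h,
      2*g - 2*h,
      -2*g - 2*h,
      2*g + 2*h,
      4*g,
      -4*g,
      12*g,
      -4*g]]

/-- cubic coefficients -/
def cubN : Fin 4 → Fin 8 → ℝ :=
  ![![0, 0, 0, 0, (-2), 0, 0, 0],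
    ![0, 0, 2, 0, 0, 0, 0, 0],
    ![2, 0, 0, 0, 0, 0, 0, 0],
    ![0, 0, 0, 0, 0, 0, 2, 0]]

theorem minorN_trace (a b c d e f g h : ℝ) (w : Fin 8 → ℝ) (hw : w = ![1, 3, 1, 3, 1, 3, 1, 3]) :
    ∑ I, w I * ∑ j, gradN a b c d e f g h j I ^ 2
      = 8 * (3*a^2 + b^2 + 3*c^2 + d^2 + 3*e^2 + f^2 + 3*g^2 + h^2)^2 := by
  subst hw
  simp [Fin.sum_univ_eight, Fin.sum_univ_four, gradN]
  ring

theorem minorN_harm (a b c d e f g h : ℝ) (w : Fin 8 → ℝ) (hw : w = ![1, 3, 1, 3, 1, 3, 1, 3])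
    (j : Fin 4) :
    ∑ I, w I * hessN a b c d e f g h j I = 0 := by
  subst hw
  fin_cases j <;> simp [Fin.sum_univ_eight, hessN] <;> ring

set_option maxHeartbeats 4000000 in
theorem minorN_eig (a b c d e f g h : ℝ) (w : Fin 8 → ℝ) (hw : w = ![1, 3, 1, 3, 1, 3, 1, 3])
    (i : Fin 4) :
    ∑ I, w I * (gradN a b c d e f g h i I *
        ∑ j, minorN a b c d e f g h j * gradN a b c d e f g h j I)
      = 4 * (3*a^2 + b^2 + 3*c^2 + d^2 + 3*e^2 + f^2 + 3*g^2 + h^2)^2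
        * minorN a b c d e f g h i := by
  subst hw
  fin_cases i <;> simp [Fin.sum_univ_eight, Fin.sum_univ_four, gradN, minorN] <;> ring

/-- line direction weights -/
noncomputable def wt (I : Fin 8) : ℝ :=
  (![1, √3, 1, √3, 1, √3, 1, √3] : Fin 8 → ℝ) I

theorem wt_sq (I : Fin 8) : wt I ^ 2 = (![1, 3, 1, 3, 1, 3, 1, 3] : Fin 8 → ℝ) I := by
  fin_cases I <;> simp [wt]

noncomputable def mm (j : Fin 4) (x : Fin 8 → ℝ) : ℝ :=
  minorN (x 0) (√3 * x 1) (x 2) (√3 * x 3) (x 4) (√3 * x 5) (x 6) (√3 * x 7) j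

noncomputable def pp (j : Fin 4) (I : Fin 8) (x : Fin 8 → ℝ) : ℝ :=
  wt I * gradN (x 0) (√3 * x 1) (x 2) (√3 * x 3) (x 4) (√3 * x 5) (x 6) (√3 * x 7) j I

noncomputable def qq (j : Fin 4) (I : Fin 8) (x : Fin 8 → ℝ) : ℝ :=
  wt I ^ 2 * hessN (x 0) (√3 * x 1) (x 2) (√3 * x 3) (x 4) (√3 * x 5) (x 6) (√3 * x 7) j I

set_option maxHeartbeats 4000000 in
theorem mm_line (j : Fin 4) (I : Fin 8) (x : Fin 8 → ℝ) (t : ℝ) :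
    mm j (x + t • Pi.single I 1) =
      mm j x + t * pp j I x + t^2 * (qq j I x / 2) + t^3 * (wt I ^ 3 * cubN j I) := by
  fin_cases j <;> fin_cases I <;>
    simp [mm, pp, qq, minorN, gradN, hessN, cubN, wt, -Real.sq_sqrt] <;> ring

set_option maxHeartbeats 4000000 in
theorem pp_line (j : Fin 4) (I : Fin 8) (x : Fin 8 → ℝ) (t : ℝ) :
    pp j I (x + t • Pi.single I 1) =
      pp j I x + t * qq j I x + t^2 * (3 * wt I ^ 3 * cubN j I) + t^3 * 0 := by
  fin_cases j <;> fin_cases I <;>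
    simp [pp, qq, gradN, hessN, cubN, wt, -Real.sq_sqrt] <;> ring

theorem mm_diff (j : Fin 4) : Differentiable ℝ (mm j) := by
  change Differentiable ℝ (fun x => mm j x)
  fin_cases j <;> simp [mm, minorN] <;> fun_prop

set_option maxHeartbeats 4000000 in
theorem pp_diff (j : Fin 4) (I : Fin 8) : Differentiable ℝ (pp j I) := by
  change Differentiable ℝ (fun x => pp j I x)
  fin_cases j <;> fin_cases I <;> simp [pp, gradN] <;> fun_prop

theorem fderiv_of_line (f : (Fin 8 → ℝ) → ℝ) (x v : Fin 8 → ℝ) (hf : DifferentiableAt ℝ f x)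
    (p c k : ℝ) (h : ∀ t : ℝ, f (x + t • v) = f x + t * p + t^2 * c + t^3 * k) :
    fderiv ℝ f x v = p := by
  rw [← hf.lineDeriv_eq_fderiv, lineDeriv]
  simp_rw [h]
  have h1 : HasDerivAt (fun t : ℝ => f x + t * p + t^2 * c + t^3 * k)
      (0 + 1 * p + (2 * 0 ^ 1 * 1) * c + (3 * 0 ^ 2 * 1) * k) 0 := by
    have hi := hasDerivAt_id (0:ℝ)
    exact (((hasDerivAt_const _ _).add (hi.mul_const p)).add ((hi.pow 2).mul_const c)).add
      ((hi.pow 3).mul_const k)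
  rw [h1.deriv]; ring

theorem fderiv_mm (j I x) : fderiv ℝ (mm j) x (Pi.single I 1) = pp j I x :=
  fderiv_of_line _ _ _ (mm_diff j x) _ _ _ (mm_line j I x)

theorem fderiv_pp (j I x) : fderiv ℝ (pp j I) x (Pi.single I 1) = qq j I x :=
  fderiv_of_line _ _ _ (pp_diff j I x) _ _ _ (pp_line j I x)

set_option maxHeartbeats 4000000 in
theorem det7 {R : Type*} [CommRing R] (t a b c d e f g h i j k l : R) :
    (!![-t, 0, 0, a, b, c, d;
       0, -t, 0, e, f, g, h;
       0, 0, -t, i, j, k, l;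
       -a, -e, -i, -t, 0, 0, 0;
       -b, -f, -j, 0, -t, 0, 0;
       -c, -g, -k, 0, 0, -t, 0;
       -d, -h, -l, 0, 0, 0, -t] : Matrix (Fin 7) (Fin 7) R).det =
    -(t^7 + t^5 * (a^2+b^2+c^2+d^2+e^2+f^2+g^2+h^2+i^2+j^2+k^2+l^2)
      + t^3 * ((a^2+b^2+c^2+d^2)*(e^2+f^2+g^2+h^2) - (a*e+b*f+c*g+d*h)^2
        + (a^2+b^2+c^2+d^2)*(i^2+j^2+k^2+l^2) - (a*i+b*j+c*k+d*l)^2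
        + (i^2+j^2+k^2+l^2)*(e^2+f^2+g^2+h^2) - (i*e+j*f+k*g+l*h)^2)
      + t * ((b*(g*l-h*k) - c*(f*l-h*j) + d*(f*k-g*j))^2
        + (a*(g*l-h*k) - c*(e*l-h*i) + d*(e*k-g*i))^2
        + (a*(f*l-h*j) - b*(e*l-h*i) + d*(e*j-f*i))^2
        + (a*(f*k-g*j) - b*(e*k-g*i) + c*(e*j-f*i))^2)) := by
  simp [Matrix.det_succ_row_zero, Fin.sum_univ_succ, Fin.succAbove]
  ring

set_option maxRecDepth 20000 in
set_option maxHeartbeats 4000000 in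
theorem Phi8_eq (x : Fin 8 → ℝ) : Phi8 x = -(1/2) * ∑ j, mm j x ^ 2 := by
  have h := det7 (X : ℝ[X]) (C (-x 2 + √3 * x 3)) (C (-x 4 + √3 * x 5))
      (C (-x 6 + √3 * x 7)) (C (-2 * x 0)) (C (-x 0 - √3 * x 1)) (C (x 6 + √3 * x 7))
      (C (-x 4 - √3 * x 5)) (C (2 * x 2)) (C (-2 * x 6)) (C (x 0 - √3 * x 1))
      (C (-x 2 - √3 * x 3)) (C (-2 * x 4))
  rw [show Matrix.det _ = charP8 x from ?_] at h
  swap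
  · unfold charP8
    refine congrArg Matrix.det ?_
    ext1 i j
    fin_cases i <;> fin_cases j <;> simp [iota8] <;> ring
  have hX : ∀ R : ℝ[X], coeff (X * R) 1 = coeff R 0 := fun R => coeff_X_mul R 0
  rw [Phi8, h, coeff_neg, coeff_add, coeff_add, coeff_add, coeff_X_pow, coeff_X_pow_mul',
    coeff_X_pow_mul', hX]
  clear h hX
  rw [if_neg (by norm_num), if_neg (by norm_num), if_neg (by norm_num),
    coeff_zero_eq_eval_zero]
  simp only [eval_add, eval_sub, eval_mul, eval_pow, eval_C]
  simp only [Fin.sum_univ_four, mm, minorN, Matrix.cons_val]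
  ring

theorem Phi8_fun : Phi8 = fun x => -(1/2) * ∑ j, mm j x ^ 2 := funext Phi8_eq

theorem fderiv_Phi (x : Fin 8 → ℝ) (I : Fin 8) :
    fderiv ℝ Phi8 x (Pi.single I 1) = -∑ j, mm j x * pp j I x := by
  have hd : ∀ j, HasFDerivAt (mm j) (fderiv ℝ (mm j) x) x := fun j => (mm_diff j x).hasFDerivAt
  have h := (HasFDerivAt.fun_sum (u := Finset.univ)
    (fun j _ => (hd j).pow 2)).const_mul (-(1/2))
  rw [Phi8_fun, h.fderiv]
  simp [fderiv_mm, Fin.sum_univ_four]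
  ring

theorem fderiv2_Phi (x : Fin 8 → ℝ) (I : Fin 8) :
    fderiv ℝ (fun y => fderiv ℝ Phi8 y (Pi.single I 1)) x (Pi.single I 1)
      = -∑ j, (pp j I x ^ 2 + mm j x * qq j I x) := by
  have hd : ∀ j, HasFDerivAt (mm j) (fderiv ℝ (mm j) x) x := fun j => (mm_diff j x).hasFDerivAt
  have hp : ∀ j, HasFDerivAt (pp j I) (fderiv ℝ (pp j I) x) x :=
    fun j => (pp_diff j I x).hasFDerivAt
  have h := (HasFDerivAt.fun_sum (u := Finset.univ)
    (fun j _ => (hd j).mul (hp j))).fun_neg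
  simp_rw [fderiv_Phi]
  have h' := h.fderiv
  simp only [Pi.mul_apply] at h'
  rw [h']
  simp [fderiv_mm, fderiv_pp, Fin.sum_univ_four]
  ring

theorem norm_eq (x : Fin 8 → ℝ) :
    3 * (x 0)^2 + (√3 * x 1)^2 + 3 * (x 2)^2 + (√3 * x 3)^2 + 3 * (x 4)^2 + (√3 * x 5)^2
      + 3 * (x 6)^2 + (√3 * x 7)^2 = 3 * ∑ i, (x i)^2 := by
  simp [Fin.sum_univ_eight, mul_pow]
  ring

/-- The sextic `Φ` satisfies `ΔΦ(x) = −72(|x|²)²` and `|∇Φ(x)|² = −72·Φ(x)·(|x|²)²`. -/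
theorem statement16 (x : Fin 8 → ℝ) :
    (∑ I, fderiv ℝ (fun y => fderiv ℝ Phi8 y (Pi.single I 1)) x (Pi.single I 1)) =
      -72 * (∑ i, (x i) ^ 2) ^ 2 ∧
    (∑ I, (fderiv ℝ Phi8 x (Pi.single I 1)) ^ 2) =
      -72 * Phi8 x * (∑ i, (x i) ^ 2) ^ 2 := by
  have hw : (fun I => wt I ^ 2) = (![1, 3, 1, 3, 1, 3, 1, 3] : Fin 8 → ℝ) := funext wt_sq
  constructor
  · have h1 := minorN_trace (x 0) (√3 * x 1) (x 2) (√3 * x 3) (x 4) (√3 * x 5) (x 6) (√3 * x 7)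
      _ hw
    have h2 := minorN_harm (x 0) (√3 * x 1) (x 2) (√3 * x 3) (x 4) (√3 * x 5) (x 6) (√3 * x 7)
      _ hw
    rw [norm_eq] at h1
    have h2' : ∀ j, ∑ I, qq j I x = 0 := h2
    have h1' : ∑ I, ∑ j, pp j I x ^ 2 = 72 * (∑ i, (x i) ^ 2) ^ 2 := by
      rw [show 72 * (∑ i, (x i) ^ 2) ^ 2 = 8 * (3 * ∑ i, (x i) ^ 2) ^ 2 by ring, ← h1]
      refine Finset.sum_congr rfl fun I _ => ?_
      simp only [pp, Fin.sum_univ_four]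
      ring
    simp only [fderiv2_Phi, Finset.sum_neg_distrib, Finset.sum_add_distrib, h1']
    rw [Finset.sum_comm]
    simp only [← Finset.mul_sum, h2']
    simp
  · have h1 := minorN_eig (x 0) (√3 * x 1) (x 2) (√3 * x 3) (x 4) (√3 * x 5) (x 6) (√3 * x 7)
      _ hw
    rw [norm_eq] at h1
    have h1' : ∀ i, ∑ I, pp i I x * ∑ j, mm j x * pp j I x
        = 36 * (∑ i, (x i) ^ 2) ^ 2 * mm i x := by
      intro i
      rw [show 36 * (∑ i, (x i) ^ 2) ^ 2 * mm i x = 4 * (3 * ∑ i, (x i) ^ 2) ^ 2 * mm i x by ring]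
      refine Eq.trans ?_ (h1 i)
      refine Finset.sum_congr rfl fun I _ => ?_
      simp only [pp, mm, Fin.sum_univ_four]
      ring
    have h3 : ∑ I, (∑ j, mm j x * pp j I x) ^ 2
        = ∑ i, mm i x * ∑ I, pp i I x * ∑ j, mm j x * pp j I x := by
      simp only [sq, Finset.mul_sum (s := (Finset.univ : Finset (Fin 8)))]
      rw [Finset.sum_comm]
      refine Finset.sum_congr rfl fun I _ => ?_
      rw [Finset.sum_mul]
      exact Finset.sum_congr rfl fun i _ => by ring
    simp only [fderiv_Phi, neg_sq]
    rw [h3]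
    simp only [h1']
    simp only [Phi8_eq, Fin.sum_univ_four]
    ring
end

section
/- Let Φ: ℝ⁸ → ℝ be the degree-6 homogeneous polynomial defined by Φ(x) = (1/2)·(coefficient of λ¹ in det(ι(x) − λ·I₇)), where ι(x) is the antisymmetric 7×7 matrix [[0₃ₓ₃, α(x)], [−α(x)ᵗ, 0₄ₓ₄]] with α(x) having rows (−x³ + √3·x⁴, −x⁵ + √3·x⁶, −x⁷ + √3·x⁸, −2x¹), (−x¹ − √3·x², x⁷ + √3·x⁸, −x⁵ − √3·x⁶, 2x³), (−2x⁷, x¹ − √3·x², −x³ − √3·x⁴, −2x⁵). Define F(x) = Φ(x) + (|x|²)³. Then F is a degree-6 homogeneous harmonic polynomial satisfying Cartan's isoparametric conditions for p = 6: ΔF = 0 identically, and |∇F(x)|² = 36·(|x|²)⁵ for all x ∈ ℝ⁸. -/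
open Matrix Polynomial

/-- Cartan's degree-6 isoparametric polynomial `F(x) = Φ(x) + (|x|²)³` on `ℝ⁸`. -/
noncomputable def F8 (x : Fin 8 → ℝ) : ℝ := Phi8 x + (∑ i, (x i) ^ 2) ^ 3

noncomputable def al8 (x : Fin 8 → ℝ) : Matrix (Fin 3) (Fin 4) ℝ :=
  !![-x 2 + Real.sqrt 3 * x 3, -x 4 + Real.sqrt 3 * x 5,
       -x 6 + Real.sqrt 3 * x 7, -2 * x 0;
     -x 0 - Real.sqrt 3 * x 1, x 6 + Real.sqrt 3 * x 7,
       -x 4 - Real.sqrt 3 * x 5, 2 * x 2;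
     -2 * x 6, x 0 - Real.sqrt 3 * x 1, -x 2 - Real.sqrt 3 * x 3, -2 * x 4]

lemma iota8_blocks_s17 (x : Fin 8 → ℝ) :
    iota8 x = Matrix.reindex finSumFinEquiv finSumFinEquiv
      (Matrix.fromBlocks (0 : Matrix (Fin 3) (Fin 3) ℝ) (al8 x) (-(al8 x)ᵀ)
        (0 : Matrix (Fin 4) (Fin 4) ℝ)) := by
  rw [← Equiv.symm_apply_eq]
  ext i j
  rcases i with i | i <;> rcases j with j | j <;> fin_cases i <;> fin_cases j <;>
    simp [iota8, al8, finSumFinEquiv] <;> (try ring)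

lemma det_blocks_gen {m n R : Type*} [Fintype m] [Fintype n] [DecidableEq m] [DecidableEq n]
    [CommRing R] [IsDomain R] (r : R) (hr : r ≠ 0) (A : Matrix m n R)
    (hm : Fintype.card m = 3) (hn : Fintype.card n = 4) :
    (Matrix.fromBlocks (-(r • (1 : Matrix m m R))) A (-Aᵀ) (-(r • (1 : Matrix n n R)))).det
      = -(r * ((r * r) • (1 : Matrix m m R) + A * Aᵀ).det) := by
  have h : Matrix.fromBlocks (-(r • (1 : Matrix m m R))) A (-Aᵀ) (-(r • (1 : Matrix n n R))) *
      Matrix.fromBlocks (r • (1 : Matrix m m R)) 0 (-Aᵀ) 1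
      = Matrix.fromBlocks (-((r * r) • (1 : Matrix m m R) + A * Aᵀ)) A 0
        (-(r • (1 : Matrix n n R))) := by
    rw [Matrix.fromBlocks_multiply]
    congr 1 <;> simp [smul_smul]
    abel
  have h2 := congrArg Matrix.det h
  have h4 : (-(r • (1 : Matrix n n R))).det = r ^ 4 := by
    rw [Matrix.det_neg, Matrix.det_smul, Matrix.det_one, hn]
    ring
  rw [Matrix.det_mul, Matrix.det_fromBlocks_zero₂₁, Matrix.det_fromBlocks_zero₁₂, h4,
    Matrix.det_one, Matrix.det_smul, Matrix.det_one, Matrix.det_neg, hm] at h2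
  have hX : r ^ 3 ≠ 0 := pow_ne_zero _ hr
  apply mul_right_cancel₀ hX
  linear_combination h2

lemma charP8_coeff (x : Fin 8 → ℝ) : (charP8 x).coeff 1 = - (al8 x * (al8 x)ᵀ).det := by
  have h : (iota8 x).map Polynomial.C
      - (Polynomial.X : Polynomial ℝ) • (1 : Matrix (Fin 7) (Fin 7) (Polynomial ℝ))
      = Matrix.reindex finSumFinEquiv finSumFinEquiv
        (Matrix.fromBlocks (-((X : ℝ[X]) • (1 : Matrix (Fin 3) (Fin 3) ℝ[X])))
          ((al8 x).map C) (-((al8 x).map C)ᵀ)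
          (-((X : ℝ[X]) • (1 : Matrix (Fin 4) (Fin 4) ℝ[X])))) := by
    rw [iota8_blocks_s17, ← Equiv.symm_apply_eq]
    ext1 i j
    rcases i with i | i <;> rcases j with j | j <;>
      simp [Matrix.one_apply]
  rw [charP8, h, Matrix.det_reindex_self, det_blocks_gen X X_ne_zero _ (Fintype.card_fin 3) (Fintype.card_fin 4),
    coeff_neg, coeff_X_mul,
    coeff_zero_eq_eval_zero, ← Polynomial.coe_evalRingHom, RingHom.map_det]
  congr 2
  ext i j
  simp [Matrix.mul_apply, Matrix.one_apply, Polynomial.eval_finsetSum]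
  split_ifs <;> simp

open MvPolynomial in
lemma fderiv_mv (P : MvPolynomial (Fin 8) ℝ) (I : Fin 8) (x : Fin 8 → ℝ) :
    DifferentiableAt ℝ (fun y => MvPolynomial.eval y P) x ∧
    fderiv ℝ (fun y => MvPolynomial.eval y P) x (Pi.single I 1)
      = MvPolynomial.eval x (MvPolynomial.pderiv I P) := by
  induction P using MvPolynomial.induction_on with
  | C a => simp
  | add p q hp hq =>
    simp only [map_add]
    refine ⟨hp.1.add hq.1, ?_⟩
    rw [fderiv_fun_add hp.1 hq.1]
    simp [hp.2, hq.2]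
  | mul_X p i hp =>
    have hi : DifferentiableAt ℝ (fun y : Fin 8 → ℝ => y i) x := by fun_prop
    simp only [map_mul, MvPolynomial.eval_X]
    refine ⟨hp.1.mul hi, ?_⟩
    rw [fderiv_fun_mul hp.1 hi]
    have : fderiv ℝ (fun y : Fin 8 → ℝ => y i) x = ContinuousLinearMap.proj i :=
      (ContinuousLinearMap.proj (R := ℝ) (φ := fun _ : Fin 8 => ℝ) i).fderiv
    rw [this]
    simp [hp.2, pderiv_X, Pi.single_apply, Derivation.leibniz]
    split_ifs <;> simp_all


/-- The four maximal minors of `α`, as polynomials. -/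
noncomputable def mP (x0 x1 x2 x3 x4 x5 x6 x7 : MvPolynomial (Fin 8) ℝ) :
    Fin 4 → MvPolynomial (Fin 8) ℝ :=
  ![
    MvPolynomial.C (1) * x2 * x2 * x6 + MvPolynomial.C (3) * x2 * x2 * x7 + MvPolynomial.C (6) *
      x1 * x2 * x4 + MvPolynomial.C (-6) * x0 * x2 * x5 + MvPolynomial.C (-9) * x3 * x3 * x6 +
      MvPolynomial.C (-27) * x3 * x3 * x7 + MvPolynomial.C (6) * x0 * x3 * x4 + MvPolynomial.C
      (-54) * x1 * x3 * x5 + MvPolynomial.C (-2) * x4 * x4 * x6 + MvPolynomial.C (18) * x5 * x5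
      * x6 + MvPolynomial.C (1) * x0 * x0 * x6 + MvPolynomial.C (-9) * x1 * x1 * x6 +
      MvPolynomial.C (-2) * x6 * x6 * x6 + MvPolynomial.C (-3) * x0 * x0 * x7 + MvPolynomial.C
      (27) * x1 * x1 * x7 + MvPolynomial.C (18) * x6 * x7 * x7,
    MvPolynomial.C (6) * x2 * x4 * x6 + MvPolynomial.C (6) * x2 * x4 * x7 + MvPolynomial.C (2) *
      x0 * x2 * x2 + MvPolynomial.C (-6) * x1 * x2 * x2 + MvPolynomial.C (-6) * x3 * x4 * x6 +
      MvPolynomial.C (-18) * x3 * x4 * x7 + MvPolynomial.C (-6) * x0 * x2 * x3 + MvPolynomial.C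
      (18) * x1 * x2 * x3 + MvPolynomial.C (2) * x0 * x4 * x4 + MvPolynomial.C (6) * x1 * x4 *
      x4 + MvPolynomial.C (-6) * x0 * x4 * x5 + MvPolynomial.C (-18) * x1 * x4 * x5 +
      MvPolynomial.C (-12) * x2 * x5 * x6 + MvPolynomial.C (2) * x0 * x0 * x0 + MvPolynomial.C
      (-18) * x0 * x1 * x1 + MvPolynomial.C (-4) * x0 * x6 * x6 + MvPolynomial.C (-12) * x0 * x6
      * x7,
    MvPolynomial.C (-2) * x2 * x4 * x4 + MvPolynomial.C (-6) * x2 * x4 * x5 + MvPolynomial.C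
      (-2) * x2 * x2 * x2 + MvPolynomial.C (6) * x3 * x4 * x4 + MvPolynomial.C (18) * x3 * x4 *
      x5 + MvPolynomial.C (18) * x2 * x3 * x3 + MvPolynomial.C (6) * x0 * x4 * x6 +
      MvPolynomial.C (6) * x1 * x4 * x6 + MvPolynomial.C (4) * x2 * x6 * x6 + MvPolynomial.C
      (-6) * x0 * x4 * x7 + MvPolynomial.C (-18) * x1 * x4 * x7 + MvPolynomial.C (-12) * x2 * x6
      * x7 + MvPolynomial.C (-2) * x0 * x0 * x2 + MvPolynomial.C (-6) * x0 * x0 * x3 +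
      MvPolynomial.C (-6) * x0 * x1 * x2 + MvPolynomial.C (-18) * x0 * x1 * x3 + MvPolynomial.C
      (12) * x0 * x5 * x6,
    MvPolynomial.C (-2) * x4 * x4 * x4 + MvPolynomial.C (-2) * x2 * x2 * x4 + MvPolynomial.C
      (-6) * x2 * x3 * x4 + MvPolynomial.C (18) * x4 * x5 * x5 + MvPolynomial.C (6) * x2 * x2 *
      x5 + MvPolynomial.C (18) * x2 * x3 * x5 + MvPolynomial.C (-2) * x4 * x6 * x6 +
      MvPolynomial.C (6) * x1 * x2 * x6 + MvPolynomial.C (18) * x4 * x7 * x7 + MvPolynomial.C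
      (12) * x0 * x2 * x7 + MvPolynomial.C (-18) * x1 * x2 * x7 + MvPolynomial.C (6) * x0 * x3 *
      x6 + MvPolynomial.C (18) * x0 * x3 * x7 + MvPolynomial.C (-2) * x0 * x0 * x4 +
      MvPolynomial.C (6) * x0 * x1 * x4 + MvPolynomial.C (-6) * x0 * x0 * x5 + MvPolynomial.C
      (18) * x0 * x1 * x5]

/-- The minors as functions. -/
def mR (a b c d e f g h : ℝ) : Fin 4 → ℝ :=
  ![
    c^2*g + (3)*c^2*h + (6)*b*c*e + (-6)*a*c*f + (-9)*d^2*g + (-27)*d^2*h + (6)*a*d*e +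
      (-54)*b*d*f + (-2)*e^2*g + (18)*f^2*g + a^2*g + (-9)*b^2*g + (-2)*g^3 + (-3)*a^2*h +
      (27)*b^2*h + (18)*g*h^2,
    (6)*c*e*g + (6)*c*e*h + (2)*a*c^2 + (-6)*b*c^2 + (-6)*d*e*g + (-18)*d*e*h + (-6)*a*c*d +
      (18)*b*c*d + (2)*a*e^2 + (6)*b*e^2 + (-6)*a*e*f + (-18)*b*e*f + (-12)*c*f*g + (2)*a^3 +
      (-18)*a*b^2 + (-4)*a*g^2 + (-12)*a*g*h,
    (-2)*c*e^2 + (-6)*c*e*f + (-2)*c^3 + (6)*d*e^2 + (18)*d*e*f + (18)*c*d^2 + (6)*a*e*g +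
      (6)*b*e*g + (4)*c*g^2 + (-6)*a*e*h + (-18)*b*e*h + (-12)*c*g*h + (-2)*a^2*c + (-6)*a^2*d +
      (-6)*a*b*c + (-18)*a*b*d + (12)*a*f*g,
    (-2)*e^3 + (-2)*c^2*e + (-6)*c*d*e + (18)*e*f^2 + (6)*c^2*f + (18)*c*d*f + (-2)*e*g^2 +
      (6)*b*c*g + (18)*e*h^2 + (12)*a*c*h + (-18)*b*c*h + (6)*a*d*g + (18)*a*d*h + (-2)*a^2*e +
      (6)*a*b*e + (-6)*a^2*f + (18)*a*b*f]

/-- Gradients of the minors (odd components divided by 3). -/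
def dR (a b c d e f g h : ℝ) : Fin 4 → Fin 8 → ℝ :=
  ![
   ![
    (-6)*c*f + (6)*d*e + (2)*a*g + (-6)*a*h,
    (2)*c*e + (-18)*d*f + (-6)*b*g + (18)*b*h,
    (2)*c*g + (6)*c*h + (6)*b*e + (-6)*a*f,
    (-6)*d*g + (-18)*d*h + (2)*a*e + (-18)*b*f,
    (6)*b*c + (6)*a*d + (-4)*e*g,
    (-2)*a*c + (-18)*b*d + (12)*f*g,
    c^2 + (-9)*d^2 + (-2)*e^2 + (18)*f^2 + a^2 + (-9)*b^2 + (-6)*g^2 + (18)*h^2,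
    c^2 + (-9)*d^2 + (-1)*a^2 + (9)*b^2 + (12)*g*h],
   ![
    (2)*c^2 + (-6)*c*d + (2)*e^2 + (-6)*e*f + (6)*a^2 + (-18)*b^2 + (-4)*g^2 + (-12)*g*h,
    (-2)*c^2 + (6)*c*d + (2)*e^2 + (-6)*e*f + (-12)*a*b,
    (6)*e*g + (6)*e*h + (4)*a*c + (-12)*b*c + (-6)*a*d + (18)*b*d + (-12)*f*g,
    (-2)*e*g + (-6)*e*h + (-2)*a*c + (6)*b*c,
    (6)*c*g + (6)*c*h + (-6)*d*g + (-18)*d*h + (4)*a*e + (12)*b*e + (-6)*a*f + (-18)*b*f,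
    (-2)*a*e + (-6)*b*e + (-4)*c*g,
    (6)*c*e + (-6)*d*e + (-12)*c*f + (-8)*a*g + (-12)*a*h,
    (2)*c*e + (-6)*d*e + (-4)*a*g],
   ![
    (6)*e*g + (-6)*e*h + (-4)*a*c + (-12)*a*d + (-6)*b*c + (-18)*b*d + (12)*f*g,
    (2)*e*g + (-6)*e*h + (-2)*a*c + (-6)*a*d,
    (-2)*e^2 + (-6)*e*f + (-6)*c^2 + (18)*d^2 + (4)*g^2 + (-12)*g*h + (-2)*a^2 + (-6)*a*b,
    (2)*e^2 + (6)*e*f + (12)*c*d + (-2)*a^2 + (-6)*a*b,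
    (-4)*c*e + (-6)*c*f + (12)*d*e + (18)*d*f + (6)*a*g + (6)*b*g + (-6)*a*h + (-18)*b*h,
    (-2)*c*e + (6)*d*e + (4)*a*g,
    (6)*a*e + (6)*b*e + (8)*c*g + (-12)*c*h + (12)*a*f,
    (-2)*a*e + (-6)*b*e + (-4)*c*g],
   ![
    (12)*c*h + (6)*d*g + (18)*d*h + (-4)*a*e + (6)*b*e + (-12)*a*f + (18)*b*f,
    (2)*c*g + (-6)*c*h + (2)*a*e + (6)*a*f,
    (-4)*c*e + (-6)*d*e + (12)*c*f + (18)*d*f + (6)*b*g + (12)*a*h + (-18)*b*h,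
    (-2)*c*e + (6)*c*f + (2)*a*g + (6)*a*h,
    (-6)*e^2 + (-2)*c^2 + (-6)*c*d + (18)*f^2 + (-2)*g^2 + (18)*h^2 + (-2)*a^2 + (6)*a*b,
    (12)*e*f + (2)*c^2 + (6)*c*d + (-2)*a^2 + (6)*a*b,
    (-4)*e*g + (6)*b*c + (6)*a*d,
    (12)*e*h + (4)*a*c + (-6)*b*c + (6)*a*d]]

set_option maxHeartbeats 4000000 in
lemma dR_gram (a b c d e f g h : ℝ) (j : Fin 4) :
    ∑ k, (dR a b c d e f g h j 0 * dR a b c d e f g h k 0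
        + 3 * (dR a b c d e f g h j 1 * dR a b c d e f g h k 1)
        + dR a b c d e f g h j 2 * dR a b c d e f g h k 2
        + 3 * (dR a b c d e f g h j 3 * dR a b c d e f g h k 3)
        + dR a b c d e f g h j 4 * dR a b c d e f g h k 4
        + 3 * (dR a b c d e f g h j 5 * dR a b c d e f g h k 5)
        + dR a b c d e f g h j 6 * dR a b c d e f g h k 6
        + 3 * (dR a b c d e f g h j 7 * dR a b c d e f g h k 7)) * mR a b c d e f g h k
      = 36 * (a^2 + 3*b^2 + c^2 + 3*d^2 + e^2 + 3*f^2 + g^2 + 3*h^2)^2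
        * mR a b c d e f g h j := by
  fin_cases j <;> simp [Fin.sum_univ_four, dR, mR] <;> ring

set_option maxHeartbeats 4000000 in
lemma dR_trace (a b c d e f g h : ℝ) :
    ∑ k, (dR a b c d e f g h k 0 ^ 2
        + 3 * dR a b c d e f g h k 1 ^ 2
        + dR a b c d e f g h k 2 ^ 2
        + 3 * dR a b c d e f g h k 3 ^ 2
        + dR a b c d e f g h k 4 ^ 2
        + 3 * dR a b c d e f g h k 5 ^ 2
        + dR a b c d e f g h k 6 ^ 2
        + 3 * dR a b c d e f g h k 7 ^ 2)
      = 72 * (a^2 + 3*b^2 + c^2 + 3*d^2 + e^2 + 3*f^2 + g^2 + 3*h^2)^2 := by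
  simp [Fin.sum_univ_four, dR]
  ring

set_option maxHeartbeats 4000000 in
lemma dR_euler (a b c d e f g h : ℝ) (k : Fin 4) :
    dR a b c d e f g h k 0 * a + 3 * (dR a b c d e f g h k 1 * b)
      + dR a b c d e f g h k 2 * c + 3 * (dR a b c d e f g h k 3 * d)
      + dR a b c d e f g h k 4 * e + 3 * (dR a b c d e f g h k 5 * f)
      + dR a b c d e f g h k 6 * g + 3 * (dR a b c d e f g h k 7 * h)
      = 3 * mR a b c d e f g h k := by
  fin_cases k <;> simp [dR, mR] <;> ring

/-- The minors as polynomials in the coordinates of `ℝ⁸`. -/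
noncomputable def mX : Fin 4 → MvPolynomial (Fin 8) ℝ :=
  mP
    (MvPolynomial.X 0)
    (MvPolynomial.C (Real.sqrt 3 / 3) * MvPolynomial.X 1)
    (MvPolynomial.X 2)
    (MvPolynomial.C (Real.sqrt 3 / 3) * MvPolynomial.X 3)
    (MvPolynomial.X 4)
    (MvPolynomial.C (Real.sqrt 3 / 3) * MvPolynomial.X 5)
    (MvPolynomial.X 6)
    (MvPolynomial.C (Real.sqrt 3 / 3) * MvPolynomial.X 7)

/-- Coordinates: every `x` is `pt a b ...`. -/
noncomputable def pt (a b c d e f g h : ℝ) : Fin 8 → ℝ :=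
  ![a, Real.sqrt 3 * b, c, Real.sqrt 3 * d, e, Real.sqrt 3 * f, g, Real.sqrt 3 * h]

/-- Scaling of the odd coordinates. -/
noncomputable def kap : Fin 8 → ℝ :=
  ![1, Real.sqrt 3, 1, Real.sqrt 3, 1, Real.sqrt 3, 1, Real.sqrt 3]

set_option maxHeartbeats 4000000 in
lemma sq3 (b : ℝ) : Real.sqrt 3 / 3 * (Real.sqrt 3 * b) = b := by
  have := Real.mul_self_sqrt (show (0:ℝ) ≤ 3 by norm_num)
  linear_combination b / 3 * this

set_option maxHeartbeats 4000000 in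
lemma eval_mX (a b c d e f g h : ℝ) (j : Fin 4) :
    MvPolynomial.eval (pt a b c d e f g h) (mX j) = mR a b c d e f g h j := by
  fin_cases j <;> simp [mX, mP, mR, pt, sq3] <;> ring

set_option maxHeartbeats 4000000 in
lemma eval_dmX (a b c d e f g h : ℝ) (j : Fin 4) (I : Fin 8) :
    MvPolynomial.eval (pt a b c d e f g h) (MvPolynomial.pderiv I (mX j))
      = kap I * dR a b c d e f g h j I := by
  fin_cases j <;> fin_cases I <;>
    simp [mX, mP, dR, pt, kap, sq3, MvPolynomial.pderiv_X] <;>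
    ring

set_option maxHeartbeats 4000000 in
lemma lap_mX (x : Fin 8 → ℝ) (j : Fin 4) :
    ∑ I, MvPolynomial.eval x (MvPolynomial.pderiv I (MvPolynomial.pderiv I (mX j))) = 0 := by
  have := Real.sq_sqrt (show (0:ℝ) ≤ 3 by norm_num)
  rw [Fin.sum_univ_eight]
  fin_cases j <;>
    simp [mX, mP, MvPolynomial.pderiv_X] <;>
    ring_nf <;> simp only [this] <;> ring_nf

set_option maxHeartbeats 4000000 in
lemma exists_pt (x : Fin 8 → ℝ) : ∃ a b c d e f g h : ℝ, x = pt a b c d e f g h := by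
  have h3 : Real.sqrt 3 ≠ 0 := by positivity
  refine ⟨x 0, x 1 / Real.sqrt 3, x 2, x 3 / Real.sqrt 3, x 4, x 5 / Real.sqrt 3, x 6,
    x 7 / Real.sqrt 3, ?_⟩
  ext i
  fin_cases i <;> simp [pt] <;> field_simp

set_option maxHeartbeats 4000000 in
lemma normsq_pt (a b c d e f g h : ℝ) : ∑ i, (pt a b c d e f g h i) ^ 2
    = a^2 + 3*b^2 + c^2 + 3*d^2 + e^2 + 3*f^2 + g^2 + 3*h^2 := by
  simp [Fin.sum_univ_eight, pt, mul_pow]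

/-- `F` as a polynomial. -/
noncomputable def PX : MvPolynomial (Fin 8) ℝ :=
  (∑ i, MvPolynomial.X i * MvPolynomial.X i) ^ 3
    - MvPolynomial.C (1 / 2) * ∑ j, mX j * mX j

set_option maxHeartbeats 4000000 in
lemma al8_pt (a b c d e f g h : ℝ) : al8 (pt a b c d e f g h) =
    !![-c + 3 * d, -e + 3 * f, -g + 3 * h, -2 * a;
       -a - 3 * b, g + 3 * h, -e - 3 * f, 2 * c;
       -2 * g, a - 3 * b, -c - 3 * d, -2 * e] := by
  have h3 (b : ℝ) : Real.sqrt 3 * (Real.sqrt 3 * b) = 3 * b := by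
    rw [← mul_assoc, Real.mul_self_sqrt (by norm_num)]
  ext i j
  fin_cases i <;> fin_cases j <;> simp [al8, pt, h3]

set_option maxHeartbeats 4000000 in
lemma cauchy_binet (a1 a2 a3 a4 b1 b2 b3 b4 c1 c2 c3 c4 : ℝ) :
    (!![a1, a2, a3, a4; b1, b2, b3, b4; c1, c2, c3, c4]
      * (!![a1, a2, a3, a4; b1, b2, b3, b4; c1, c2, c3, c4])ᵀ).det
    = (a1 * (b2 * c3 - b3 * c2) - a2 * (b1 * c3 - b3 * c1) + a3 * (b1 * c2 - b2 * c1)) ^ 2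
    + (a1 * (b2 * c4 - b4 * c2) - a2 * (b1 * c4 - b4 * c1) + a4 * (b1 * c2 - b2 * c1)) ^ 2
    + (a1 * (b3 * c4 - b4 * c3) - a3 * (b1 * c4 - b4 * c1) + a4 * (b1 * c3 - b3 * c1)) ^ 2
    + (a2 * (b3 * c4 - b4 * c3) - a3 * (b2 * c4 - b4 * c2) + a4 * (b2 * c3 - b3 * c2)) ^ 2 := by
  rw [Matrix.det_fin_three]
  simp [Matrix.mul_apply, Fin.sum_univ_four]
  ring

set_option maxHeartbeats 4000000 in
lemma det_al8 (a b c d e f g h : ℝ) :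
    (al8 (pt a b c d e f g h) * (al8 (pt a b c d e f g h))ᵀ).det
      = ∑ j, mR a b c d e f g h j * mR a b c d e f g h j := by
  rw [al8_pt, cauchy_binet, Fin.sum_univ_four]
  simp only [← pow_two]
  congr 1
  · congr 1
    · congr 1
      · congr 1
        simp [mR]
        ring
      · congr 1
        simp [mR]
        ring
    · congr 1
      simp [mR]
      ring
  · congr 1
    simp [mR]
    ring

set_option maxHeartbeats 4000000 in
lemma F8_eq : F8 = fun x => MvPolynomial.eval x PX := by
  funext x
  obtain ⟨a, b, c, d, e, f, g, h, rfl⟩ := exists_pt x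
  rw [F8, Phi8, charP8_coeff, det_al8]
  simp only [PX, map_sub, map_pow, map_mul, map_sum, MvPolynomial.eval_X, MvPolynomial.eval_C,
    eval_mX, pow_two]
  ring

set_option maxHeartbeats 4000000 in
lemma fderiv_F8 (I : Fin 8) (x : Fin 8 → ℝ) :
    fderiv ℝ F8 x (Pi.single I 1) = MvPolynomial.eval x (MvPolynomial.pderiv I PX) := by
  rw [F8_eq]
  exact (fderiv_mv PX I x).2

set_option maxHeartbeats 4000000 in
lemma pderiv_PX (I : Fin 8) : MvPolynomial.pderiv I PX
    = MvPolynomial.C 6 * (∑ i, MvPolynomial.X i * MvPolynomial.X i) ^ 2 * MvPolynomial.X I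
      - ∑ j, mX j * MvPolynomial.pderiv I (mX j) := by
  have h1 : MvPolynomial.pderiv I (∑ i, MvPolynomial.X i * MvPolynomial.X i :
      MvPolynomial (Fin 8) ℝ) = MvPolynomial.C 2 * MvPolynomial.X I := by
    rw [map_sum, Finset.sum_eq_single I]
    · rw [MvPolynomial.pderiv_mul, MvPolynomial.pderiv_X_self, map_ofNat]
      ring
    · intro i _ hi
      rw [MvPolynomial.pderiv_mul, MvPolynomial.pderiv_X_of_ne hi]
      ring
    · simp
  have h2 : MvPolynomial.C (1 / 2) * (2 : MvPolynomial (Fin 8) ℝ) = 1 := by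
    rw [← map_ofNat MvPolynomial.C 2, ← map_mul]
    norm_num
  rw [PX, map_sub, MvPolynomial.pderiv_pow, h1, MvPolynomial.pderiv_C_mul, map_sum]
  simp only [MvPolynomial.pderiv_mul]
  rw [Finset.mul_sum]
  congr 1
  · simp only [map_ofNat]
    push_cast
    ring
  · refine Finset.sum_congr rfl fun j _ => ?_
    linear_combination (mX j * MvPolynomial.pderiv I (mX j)) * h2

set_option maxHeartbeats 4000000 in
lemma pderiv2_PX (I : Fin 8) : MvPolynomial.pderiv I (MvPolynomial.pderiv I PX)
    = MvPolynomial.C 6 * (∑ i, MvPolynomial.X i * MvPolynomial.X i) ^ 2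
      + MvPolynomial.C 24 * (∑ i, MvPolynomial.X i * MvPolynomial.X i)
        * (MvPolynomial.X I * MvPolynomial.X I)
      - ∑ j, (MvPolynomial.pderiv I (mX j) * MvPolynomial.pderiv I (mX j)
        + mX j * MvPolynomial.pderiv I (MvPolynomial.pderiv I (mX j))) := by
  have h1 : MvPolynomial.pderiv I (∑ i, MvPolynomial.X i * MvPolynomial.X i :
      MvPolynomial (Fin 8) ℝ) = MvPolynomial.C 2 * MvPolynomial.X I := by
    rw [map_sum, Finset.sum_eq_single I]
    · rw [MvPolynomial.pderiv_mul, MvPolynomial.pderiv_X_self, map_ofNat]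
      ring
    · intro i _ hi
      rw [MvPolynomial.pderiv_mul, MvPolynomial.pderiv_X_of_ne hi]
      ring
    · simp
  rw [pderiv_PX, map_sub, map_sum, MvPolynomial.pderiv_mul, MvPolynomial.pderiv_C_mul,
    MvPolynomial.pderiv_pow, h1, MvPolynomial.pderiv_X_self]
  simp only [MvPolynomial.pderiv_mul]
  congr 1
  simp only [map_ofNat]
  push_cast
  ring

set_option maxHeartbeats 4000000 in
lemma laplace_F8 (x : Fin 8 → ℝ) :
    (∑ I, fderiv ℝ (fun y => fderiv ℝ F8 y (Pi.single I 1)) x (Pi.single I 1)) = 0 := by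
  have h0 : ∀ I, fderiv ℝ (fun y => fderiv ℝ F8 y (Pi.single I 1)) x (Pi.single I 1)
      = MvPolynomial.eval x (MvPolynomial.pderiv I (MvPolynomial.pderiv I PX)) := by
    intro I
    simp only [fderiv_F8]
    exact (fderiv_mv _ I x).2
  simp only [h0, pderiv2_PX]
  simp only [map_sub, map_add, map_pow, map_mul, map_sum, MvPolynomial.eval_X,
    MvPolynomial.eval_C]
  rw [Finset.sum_sub_distrib, Finset.sum_add_distrib, ← Finset.mul_sum, Finset.sum_comm]
  simp only [Finset.sum_add_distrib, ← Finset.mul_sum, lap_mX]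
  obtain ⟨a, b, c, d, e, f, g, h, rfl⟩ := exists_pt x
  have hn := normsq_pt a b c d e f g h
  simp only [pow_two (pt a b c d e f g h _)] at hn
  simp only [eval_dmX, hn]
  have h3 := Real.sq_sqrt (show (0:ℝ) ≤ 3 by norm_num)
  have ht := dR_trace a b c d e f g h
  have hs : ∀ k, ∑ I, kap I * dR a b c d e f g h k I * (kap I * dR a b c d e f g h k I)
      = (dR a b c d e f g h k 0 ^ 2
        + 3 * dR a b c d e f g h k 1 ^ 2
        + dR a b c d e f g h k 2 ^ 2
        + 3 * dR a b c d e f g h k 3 ^ 2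
        + dR a b c d e f g h k 4 ^ 2
        + 3 * dR a b c d e f g h k 5 ^ 2
        + dR a b c d e f g h k 6 ^ 2
        + 3 * dR a b c d e f g h k 7 ^ 2) := by
    intro k
    rw [Fin.sum_univ_eight]
    generalize dR a b c d e f g h k = D
    simp [kap]
    linear_combination (D 1 ^ 2 + D 3 ^ 2 + D 5 ^ 2 + D 7 ^ 2) * h3
  simp only [hs, ht]
  simp
  ring

set_option maxHeartbeats 4000000 in
lemma grad_F8 (x : Fin 8 → ℝ) :
    (∑ I, (fderiv ℝ F8 x (Pi.single I 1)) ^ 2) = 36 * (∑ i, (x i) ^ 2) ^ 5 := by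
  simp only [fderiv_F8, pderiv_PX]
  simp only [map_sub, map_add, map_pow, map_mul, map_sum, MvPolynomial.eval_X,
    MvPolynomial.eval_C]
  obtain ⟨a, b, c, d, e, f, g, h, rfl⟩ := exists_pt x
  have hn := normsq_pt a b c d e f g h
  have hn2 := hn
  simp only [pow_two (pt a b c d e f g h _)] at hn2
  simp only [eval_dmX, eval_mX, hn, hn2]
  have h3 := Real.sq_sqrt (show (0:ℝ) ≤ 3 by norm_num)
  have he := dR_euler a b c d e f g h
  have hg := dR_gram a b c d e f g h
  set n := a^2 + 3*b^2 + c^2 + 3*d^2 + e^2 + 3*f^2 + g^2 + 3*h^2 with hnd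
  generalize dR a b c d e f g h = D at *
  generalize mR a b c d e f g h = m at *
  have g0 := hg 0
  have g1 := hg 1
  have g2 := hg 2
  have g3 := hg 3
  have e0 := he 0
  have e1 := he 1
  have e2 := he 2
  have e3 := he 3
  simp only [Fin.sum_univ_four] at g0 g1 g2 g3 ⊢
  have key : ∀ I, (6 * n ^ 2 * pt a b c d e f g h I - (m 0 * (kap I * D 0 I)
      + m 1 * (kap I * D 1 I) + m 2 * (kap I * D 2 I) + m 3 * (kap I * D 3 I))) ^ 2
      = kap I ^ 2 * (6 * n ^ 2 * ![a, b, c, d, e, f, g, h] I - (m 0 * D 0 I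
      + m 1 * D 1 I + m 2 * D 2 I + m 3 * D 3 I)) ^ 2 := by
    intro I
    have : pt a b c d e f g h I = kap I * ![a, b, c, d, e, f, g, h] I := by
      fin_cases I <;> simp [pt, kap]
    rw [this]
    ring
  simp only [key]
  rw [Fin.sum_univ_eight]
  simp [kap]
  clear_value n
  linear_combination m 0 * g0 + m 1 * g1 + m 2 * g2 + m 3 * g3
    - 12 * n ^ 2 * (m 0 * e0 + m 1 * e1 + m 2 * e2 + m 3 * e3) - 36 * n ^ 4 * hnd

set_option maxHeartbeats 4000000 in
lemma homog_F8 (t : ℝ) (x : Fin 8 → ℝ) : F8 (t • x) = t ^ 6 * F8 x := by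
  have h : al8 (t • x) = t • al8 x := by
    ext i j
    fin_cases i <;> fin_cases j <;> simp [al8] <;> ring
  have h2 : ∑ i, ((t • x) i) ^ 2 = t ^ 2 * ∑ i, (x i) ^ 2 := by
    simp [mul_pow, Finset.mul_sum]
  rw [F8, F8, Phi8, Phi8, charP8_coeff, charP8_coeff, h, h2]
  simp [Matrix.transpose_smul, Matrix.det_smul]
  ring

/-- `F = Φ + (|x|²)³` is homogeneous of degree 6, harmonic (`ΔF = 0`), and satisfies
Cartan's condition `|∇F(x)|² = 36(|x|²)⁵` for `p = 6`. -/
theorem statement17 :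
    (∀ (t : ℝ) (x : Fin 8 → ℝ), F8 (t • x) = t ^ 6 * F8 x) ∧
    (∀ x : Fin 8 → ℝ,
      (∑ I, fderiv ℝ (fun y => fderiv ℝ F8 y (Pi.single I 1)) x (Pi.single I 1)) = 0) ∧
    (∀ x : Fin 8 → ℝ,
      (∑ I, (fderiv ℝ F8 x (Pi.single I 1)) ^ 2) = 36 * (∑ i, (x i) ^ 2) ^ 5) := by
  exact ⟨homog_F8, laplace_F8, grad_F8⟩
end
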